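/- Suppose the Markov operator P with transition probability function {P_x : x ∈ X} and the family {Q_{x,y}} satisfy assumptions A0–A4. Then there exist q ∈ (0,1) and C > 0 such that ‖P^{*n}δ_x − P^{*n}δ_y‖_FM ≤ q^n C (L(x) + L(y) + 1) for all x,y ∈ X and n ∈ ℕ, where δ_x denotes the Dirac measure at x. -/

import Mathlib

open MeasureTheory ProbabilityTheory Filter Set
open scoped ENNReal NNReal

noncomputable section

/-- The Fortet–Mourier distance between two Borel measures. -/
def fmDist {X : Type*} [MetricSpace X] [MeasurableSpace X] (μ ν : Measure X) : ℝ :=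
  sSup {r : ℝ | ∃ f : X → ℝ, Continuous f ∧ (∀ x, |f x| ≤ 1) ∧
    (∀ x y, |f x - f y| ≤ dist x y) ∧ r = |∫ x, f x ∂μ - ∫ x, f x ∂ν|}

/-- The (topological) support of a measure. -/
def measSupport {X : Type*} [TopologicalSpace X] [MeasurableSpace X] (μ : Measure X) : Set X :=
  {x | ∀ U : Set X, IsOpen U → x ∈ U → 0 < μ U}

/-- `geomInv t n = (t⁻¹)^n`, i.e. `t^{-n}`, with value `∞` at `n = ∞`. -/
def geomInv (t : ℝ) (n : ℕ∞) : ℝ≥0∞ :=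
  if n = ⊤ then ⊤ else ENNReal.ofReal (t⁻¹ ^ n.toNat)

/-- Prepend a point to a path. -/
def prepend {Y : Type*} (y : Y) (ω : ℕ → Y) : ℕ → Y :=
  fun n => Nat.casesOn n y ω

/-- The measures `R_{x,y}` built from the transition function `P` and the family `Q`. -/
def Rpart {X : Type*} [MeasurableSpace X] (P : Kernel X X) (Q : Kernel (X × X) (X × X))
    (z : X × X) : Measure (X × X) :=
  if Q z Set.univ < 1 then
    (1 - Q z Set.univ)⁻¹ • ((P z.1 - (Q z).fst).prod (P z.2 - (Q z).snd))
  else 0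

/-- The coupling `B_{x,y} = Q_{x,y} + R_{x,y}`. -/
def Bpart {X : Type*} [MeasurableSpace X] (P : Kernel X X) (Q : Kernel (X × X) (X × X))
    (z : X × X) : Measure (X × X) :=
  Q z + Rpart P Q z


/-! ### The coupling measures -/

section Coupling

variable {X : Type*} [MeasurableSpace X] {P : Kernel X X} [IsMarkovKernel P]
  {Q : Kernel (X × X) (X × X)} {z : X × X}

lemma sub_univ_of_le {Y : Type*} [MeasurableSpace Y] {μ ν : Measure Y} [IsProbabilityMeasure μ]
    [IsFiniteMeasure ν] (h : ν ≤ μ) : (μ - ν) univ = 1 - ν univ := by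
  rw [Measure.sub_apply MeasurableSet.univ h, measure_univ]

lemma smul_inv_one_sub_eq {Y : Type*} [MeasurableSpace Y] {μ ν : Measure Y}
    (hν : ν univ < 1) :
    (1 - ν univ)⁻¹ • (1 - ν univ) • (μ - ν) = μ - ν := by
  rw [smul_smul, ENNReal.inv_mul_cancel (tsub_pos_of_lt hν).ne'
    (ENNReal.sub_ne_top ENNReal.one_ne_top), one_smul]

lemma sub_eq_zero_of_not_lt {Y : Type*} [MeasurableSpace Y] {μ ν : Measure Y}
    [IsProbabilityMeasure μ] [IsFiniteMeasure ν] (h : ν ≤ μ) (hν : ¬ ν univ < 1) :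
    μ - ν = 0 := by
  rw [← Measure.measure_univ_eq_zero, sub_univ_of_le h, tsub_eq_zero_iff_le]
  exact not_lt.mp hν

lemma Rpart_fst [IsFiniteMeasure (Q z)] (h₁ : (Q z).fst ≤ P z.1) (h₂ : (Q z).snd ≤ P z.2) :
    (Rpart P Q z).fst = P z.1 - (Q z).fst := by
  unfold Rpart
  split_ifs with h
  · rw [Measure.fst, Measure.map_smul, Measure.map_fst_prod, sub_univ_of_le h₂,
      Measure.snd_univ, ← Measure.fst_univ]
    exact smul_inv_one_sub_eq (by rwa [Measure.fst_univ])
  · rw [sub_eq_zero_of_not_lt h₁ (by rwa [Measure.fst_univ]), Measure.fst_zero]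

lemma Rpart_snd [IsFiniteMeasure (Q z)] (h₁ : (Q z).fst ≤ P z.1) (h₂ : (Q z).snd ≤ P z.2) :
    (Rpart P Q z).snd = P z.2 - (Q z).snd := by
  unfold Rpart
  split_ifs with h
  · rw [Measure.snd, Measure.map_smul, Measure.map_snd_prod, sub_univ_of_le h₁,
      Measure.fst_univ, ← Measure.snd_univ]
    exact smul_inv_one_sub_eq (by rwa [Measure.snd_univ])
  · rw [sub_eq_zero_of_not_lt h₂ (by rwa [Measure.snd_univ]), Measure.snd_zero]

lemma Rpart_univ [IsFiniteMeasure (Q z)] (h₁ : (Q z).fst ≤ P z.1) (h₂ : (Q z).snd ≤ P z.2) :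
    Rpart P Q z univ = 1 - Q z univ := by
  rw [← Measure.fst_univ, Rpart_fst h₁ h₂, sub_univ_of_le h₁, Measure.fst_univ]

lemma Bpart_fst [IsFiniteMeasure (Q z)] (h₁ : (Q z).fst ≤ P z.1) (h₂ : (Q z).snd ≤ P z.2) :
    (Bpart P Q z).fst = P z.1 := by
  rw [Bpart, Measure.fst_add, Rpart_fst h₁ h₂, add_comm, Measure.sub_add_cancel_of_le h₁]

lemma Bpart_snd [IsFiniteMeasure (Q z)] (h₁ : (Q z).fst ≤ P z.1) (h₂ : (Q z).snd ≤ P z.2) :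
    (Bpart P Q z).snd = P z.2 := by
  rw [Bpart, Measure.snd_add, Rpart_snd h₁ h₂, add_comm, Measure.sub_add_cancel_of_le h₂]

lemma isProbabilityMeasure_Bpart [IsFiniteMeasure (Q z)] (h₁ : (Q z).fst ≤ P z.1)
    (h₂ : (Q z).snd ≤ P z.2) : IsProbabilityMeasure (Bpart P Q z) :=
  ⟨by rw [← Measure.fst_univ, Bpart_fst h₁ h₂, measure_univ]⟩

end Coupling

/-! ### A weak Harris contraction -/

section Harris

/-- The product weight `√(D · (1 + η H))`, with `D` a contracting distance-like function and
`H` a Lyapunov function. -/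
def harrisWeight {Y : Type*} (D H : Y → ℝ≥0∞) (η : ℝ) (w : Y) : ℝ≥0∞ :=
  D w ^ (1 / 2 : ℝ) * (1 + ENNReal.ofReal η * H w) ^ (1 / 2 : ℝ)

/-- If `D` is non-expanded by `B` and contracted on `K`, and `H` is contracted outside `K` and
bounded after one step from `K`, then a suitable product weight is contracted everywhere. -/
theorem exists_harrisWeight_contraction {Y : Type*} [MeasurableSpace Y] (B : Y → Measure Y)
    [∀ z, IsProbabilityMeasure (B z)] {D H : Y → ℝ≥0∞} (hDm : Measurable D) (hHm : Measurable H)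
    {K : Set Y} {q s M : ℝ} (hq : q ∈ Ioo (0 : ℝ) 1) (hs : s ∈ Ioo (0 : ℝ) 1) (hM : 0 < M)
    (hD : ∀ z, ∫⁻ w, D w ∂B z ≤ D z)
    (hDK : ∀ z ∈ K, ∫⁻ w, D w ∂B z ≤ ENNReal.ofReal q * D z)
    (hH : ∀ z, 1 ≤ H z)
    (hHK : ∀ z ∈ K, ∫⁻ w, H w ∂B z ≤ ENNReal.ofReal M)
    (hHoff : ∀ z ∉ K, ∫⁻ w, H w ∂B z ≤ ENNReal.ofReal s * H z) :
    ∃ ρ η : ℝ, ρ ∈ Ioo (0 : ℝ) 1 ∧ 0 < η ∧ ∀ z,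
      ∫⁻ w, harrisWeight D H η w ∂B z ≤ ENNReal.ofReal ρ * harrisWeight D H η z := by
  obtain ⟨hq0, hq1⟩ := hq
  obtain ⟨hs0, hs1⟩ := hs
  set η : ℝ := (1 - q) / (2 * q * M) with hη
  have hη0 : 0 < η := div_pos (by linarith) (by positivity)
  set σ : ℝ := max ((1 + q) / 2) ((1 + η * s) / (1 + η)) with hσ
  have hσ0 : 0 < σ := lt_max_of_lt_left (by linarith)
  have hσ1 : σ < 1 := by
    refine max_lt (by linarith) ((div_lt_one (by linarith)).2 ?_)
    nlinarith
  have hσK : q * (1 + η * M) ≤ σ := by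
    refine le_trans (le_of_eq ?_) (le_max_left _ _)
    rw [hη]; field_simp; ring
  have hσoff : 1 + η * s ≤ σ * (1 + η) := by
    rw [← div_le_iff₀ (by linarith)]; exact le_max_right _ _
  have hσs : s ≤ σ := by
    have : s * (1 + η) ≤ 1 + η * s := by linarith
    by_contra h
    push Not at h
    nlinarith
  refine ⟨σ ^ (1 / 2 : ℝ), η, ⟨by positivity, Real.rpow_lt_one hσ0.le hσ1 (by norm_num)⟩,
    hη0, fun z => ?_⟩
  have hG : ∫⁻ w, (1 + ENNReal.ofReal η * H w) ∂B z
      = 1 + ENNReal.ofReal η * ∫⁻ w, H w ∂B z := by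
    rw [lintegral_add_left measurable_const, lintegral_const_mul _ hHm]; simp
  have key : (∫⁻ w, D w ∂B z) * (∫⁻ w, (1 + ENNReal.ofReal η * H w) ∂B z)
      ≤ ENNReal.ofReal σ * (D z * (1 + ENNReal.ofReal η * H z)) := by
    rw [hG]
    by_cases hz : z ∈ K
    · calc (∫⁻ w, D w ∂B z) * (1 + ENNReal.ofReal η * ∫⁻ w, H w ∂B z)
          ≤ (ENNReal.ofReal q * D z) * (1 + ENNReal.ofReal η * ENNReal.ofReal M) := by
            gcongr
            · exact hDK z hz
            · exact hHK z hz
        _ = ENNReal.ofReal (q * (1 + η * M)) * D z := by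
            rw [ENNReal.ofReal_mul hq0.le, ENNReal.ofReal_add zero_le_one (by positivity),
              ENNReal.ofReal_mul hη0.le, ENNReal.ofReal_one]
            ring
        _ ≤ ENNReal.ofReal σ * (D z * 1) := by rw [mul_one]; gcongr
        _ ≤ _ := by gcongr; exact le_self_add
    · have hstep : 1 + ENNReal.ofReal η * (ENNReal.ofReal s * H z)
          ≤ ENNReal.ofReal σ * (1 + ENNReal.ofReal η * H z) := by
        calc 1 + ENNReal.ofReal η * (ENNReal.ofReal s * H z)
            = ENNReal.ofReal 1 + ENNReal.ofReal (η * s) * H z := by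
              rw [ENNReal.ofReal_mul hη0.le, ENNReal.ofReal_one, mul_assoc]
          _ ≤ ENNReal.ofReal (σ + η * (σ - s)) + ENNReal.ofReal (η * s) * H z := by
              gcongr; linarith
          _ = ENNReal.ofReal σ + ENNReal.ofReal (η * (σ - s)) * 1
                + ENNReal.ofReal (η * s) * H z := by
              rw [ENNReal.ofReal_add hσ0.le (mul_nonneg hη0.le (by linarith)), mul_one]
          _ ≤ ENNReal.ofReal σ + ENNReal.ofReal (η * (σ - s)) * H z
                + ENNReal.ofReal (η * s) * H z := by
              gcongr; exact hH z
          _ = ENNReal.ofReal σ + ENNReal.ofReal (σ * η) * H z := by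
              rw [add_assoc, ← add_mul, ← ENNReal.ofReal_add
                (mul_nonneg hη0.le (by linarith)) (by positivity)]
              congr 3; ring
          _ = _ := by rw [ENNReal.ofReal_mul hσ0.le]; ring
      calc (∫⁻ w, D w ∂B z) * (1 + ENNReal.ofReal η * ∫⁻ w, H w ∂B z)
          ≤ D z * (1 + ENNReal.ofReal η * (ENNReal.ofReal s * H z)) := by
            gcongr
            · exact hD z
            · exact hHoff z hz
        _ ≤ D z * (ENNReal.ofReal σ * (1 + ENNReal.ofReal η * H z)) := by gcongr
        _ = _ := by ring
  calc ∫⁻ w, harrisWeight D H η w ∂B z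
      ≤ (∫⁻ w, D w ∂B z) ^ (1 / 2 : ℝ)
          * (∫⁻ w, (1 + ENNReal.ofReal η * H w) ∂B z) ^ (1 / 2 : ℝ) :=
        ENNReal.lintegral_mul_norm_pow_le hDm.aemeasurable
          (measurable_const.add (hHm.const_mul _)).aemeasurable
          (by norm_num) (by norm_num) (by norm_num)
    _ = ((∫⁻ w, D w ∂B z) * (∫⁻ w, (1 + ENNReal.ofReal η * H w) ∂B z)) ^ (1 / 2 : ℝ) :=
        (ENNReal.mul_rpow_of_nonneg _ _ (by norm_num)).symm
    _ ≤ (ENNReal.ofReal σ * (D z * (1 + ENNReal.ofReal η * H z))) ^ (1 / 2 : ℝ) := by gcongr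
    _ = _ := by
        rw [ENNReal.mul_rpow_of_nonneg _ _ (by norm_num),
          ENNReal.mul_rpow_of_nonneg _ _ (by norm_num),
          ENNReal.ofReal_rpow_of_nonneg hσ0.le (by norm_num), harrisWeight]

end Harris

/-! ### The contracting distance-like function -/

section Distance

/-- The profile `φ` turning a distance into a function contracted by the coupling, together with
its deficit `e` below `1`. -/
theorem exists_profile {α δ l ν : ℝ} (hα : α ∈ Ioo (0 : ℝ) 1) (hδ : 0 < δ)
    (hν : ν ∈ Ioc (0 : ℝ) 1) :
    ∃ (φ e : ℝ → ℝ) (N q A : ℝ), Measurable φ ∧ 0 < N ∧ q ∈ Ioo (0 : ℝ) 1 ∧ 0 < A ∧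
      (∀ t, 0 ≤ t → 0 ≤ φ t ∧ φ t ≤ 1 ∧ φ t ≤ N * t ^ ν ∧ min 2 t ≤ A * φ t) ∧
      (∀ t, 0 ≤ t → e t ∈ Ioo (0 : ℝ) 1) ∧ AntitoneOn e (Ici 0) ∧
      (∀ t, 0 ≤ t → N * t ^ ν ≤ 1 → (N * α ^ ν + l) * t ^ ν ≤ q * φ t) ∧
      (∀ t, 0 ≤ t → ∀ u, 0 ≤ u → u ≤ t → φ u ≤ 1 - e t) ∧
      (∀ t, 0 ≤ t → 1 < N * t ^ ν → 1 - δ * e (α * t) ≤ (1 - e t) * φ t) := by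
  obtain ⟨hα0, hα1⟩ := hα
  obtain ⟨hν0, hν1⟩ := hν
  set a : ℝ := α ^ ν with ha
  have ha0 : 0 < a := Real.rpow_pos_of_pos hα0 _
  have ha1 : a < 1 := Real.rpow_lt_one hα0.le hα1 hν0
  set b : ℝ := (1 + a) / 2 with hb
  have hb0 : 0 < b := by linarith
  have hb1 : b < 1 := by linarith
  set ε : ℝ := (1 - b) / 2 with hε
  have hε0 : 0 < ε := by linarith
  have hε1 : ε < 1 := by linarith
  set N : ℝ := max 1 (2 * l / (1 - a)) with hN
  have hN1 : 1 ≤ N := le_max_left _ _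
  have hN0 : 0 < N := by linarith
  have hNl : N * a + l ≤ N * b := by
    have h : 2 * l / (1 - a) ≤ N := le_max_right _ _
    rw [div_le_iff₀ (by linarith)] at h
    rw [hb]; linarith
  set r : ℝ := (1 / N) ^ ν⁻¹ with hr
  have hr0 : 0 < r := by positivity
  have hrν : r ^ ν = 1 / N := Real.rpow_inv_rpow (by positivity) hν0.ne'
  obtain ⟨m, hm⟩ := exists_pow_lt_of_lt_one (by positivity : 0 < δ / 4) hα1
  set κ : ℝ := 4 / (δ * r ^ m) with hκ
  have hκ0 : 0 < κ := by positivity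
  set e : ℝ → ℝ := fun t => ε / (1 + κ * t ^ m) with he
  have hden : ∀ t : ℝ, 0 ≤ t → 1 ≤ 1 + κ * t ^ m := fun t ht => by
    have : 0 ≤ κ * t ^ m := by positivity
    linarith
  have he0 : ∀ t : ℝ, 0 ≤ t → 0 < e t := fun t ht =>
    div_pos hε0 (by linarith [hden t ht])
  have heε : ∀ t : ℝ, 0 ≤ t → e t ≤ ε := fun t ht => div_le_self hε0.le (hden t ht)
  have hanti : AntitoneOn e (Ici 0) := fun s hs t _ hst => by
    have hs0 : (0 : ℝ) ≤ s := hs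
    have := hden s hs0
    simp only [he]
    gcongr
  set φ : ℝ → ℝ := fun t => min 1 (N * t ^ ν) * (1 - e t) with hφ
  have hmin0 : ∀ t : ℝ, 0 ≤ t → 0 ≤ min 1 (N * t ^ ν) := fun t ht =>
    le_min zero_le_one (by positivity)
  have hφle : ∀ t : ℝ, 0 ≤ t → φ t ≤ min 1 (N * t ^ ν) := fun t ht =>
    mul_le_of_le_one_right (hmin0 t ht) (by linarith [he0 t ht])
  have hφge : ∀ t : ℝ, 0 ≤ t → (1 - ε) * min 1 (N * t ^ ν) ≤ φ t := fun t ht => by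
    rw [mul_comm]
    exact mul_le_mul_of_nonneg_left (by linarith [heε t ht]) (hmin0 t ht)
  refine ⟨φ, e, N, b / (1 - ε), 2 / (1 - ε), ?_, hN0, ⟨div_pos hb0 (by linarith), ?_⟩,
    div_pos two_pos (by linarith), fun t ht => ⟨?_, ?_, ?_, ?_⟩,
    fun t ht => ⟨he0 t ht, (heε t ht).trans_lt hε1⟩, hanti, fun t ht h => ?_,
    fun t ht u hu hut => ?_, fun t ht h => ?_⟩
  · simp only [hφ, he]
    fun_prop
  · rw [div_lt_one (by linarith)]; linarith
  · exact mul_nonneg (hmin0 t ht) (by linarith [heε t ht])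
  · exact (hφle t ht).trans (min_le_left _ _)
  · exact (hφle t ht).trans (min_le_right _ _)
  · have h1 : min 2 t ≤ 2 * min 1 (N * t ^ ν) := by
      rcases le_total t 1 with h | h
      · have h2 : t ≤ t ^ ν := Real.self_le_rpow_of_le_one ht h hν1
        have h3 : t ≤ N * t ^ ν := h2.trans (le_mul_of_one_le_left (by positivity) hN1)
        have h4 : t ≤ min 1 (N * t ^ ν) := le_min h h3
        linarith [min_le_right 2 t]
      · have h2 : 1 ≤ N * t ^ ν := one_le_mul_of_one_le_of_one_le hN1
          (Real.one_le_rpow h hν0.le)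
        rw [min_eq_left h2]
        linarith [min_le_left 2 t]
    calc min 2 t ≤ 2 * min 1 (N * t ^ ν) := h1
      _ = 2 / (1 - ε) * ((1 - ε) * min 1 (N * t ^ ν)) := by
        field_simp [(by linarith : (1 - ε) ≠ 0)]
      _ ≤ _ := mul_le_mul_of_nonneg_left (hφge t ht) (div_nonneg two_pos.le (by linarith))
  · calc (N * a + l) * t ^ ν ≤ N * b * t ^ ν := by gcongr
      _ = b / (1 - ε) * ((1 - ε) * min 1 (N * t ^ ν)) := by
        rw [min_eq_right h]; field_simp [(by linarith : (1 - ε) ≠ 0)]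
      _ ≤ _ := mul_le_mul_of_nonneg_left (hφge t ht) (div_nonneg hb0.le (by linarith))
  · have h1 : φ u ≤ 1 * (1 - e u) :=
      mul_le_mul_of_nonneg_right (min_le_left _ _) (by linarith [heε u hu])
    linarith [hanti hu ht hut]
  · have hφt : φ t = 1 - e t := by simp only [hφ, min_eq_left h.le, one_mul]
    have hrt : r ≤ t := by
      by_contra! hlt
      have : t ^ ν ≤ r ^ ν := Real.rpow_le_rpow ht hlt.le hν0.le
      have h2 : N * t ^ ν ≤ N * (1 / N) := by rw [← hrν]; gcongr
      rw [mul_one_div_cancel hN0.ne'] at h2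
      linarith
    have hκt : 4 ≤ δ * (κ * t ^ m) := by
      calc (4 : ℝ) = δ * (κ * r ^ m) := by rw [hκ]; field_simp
        _ ≤ _ := by gcongr
    have h2 : 2 * e t ≤ δ * e (α * t) := by
      have hαt : 0 ≤ α * t := by positivity
      simp only [he]
      rw [← mul_div_assoc 2 ε, ← mul_div_assoc δ ε, div_le_div_iff₀ (by linarith [hden t ht])
        (by linarith [hden _ hαt]), mul_pow]
      have h3 : α ^ m * (κ * t ^ m) ≤ δ / 4 * (κ * t ^ m) := by gcongr
      have h4 : 2 * (1 + κ * (α ^ m * t ^ m)) ≤ δ * (1 + κ * t ^ m) := by nlinarith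
      nlinarith [mul_le_mul_of_nonneg_left h4 hε0.le]
    rw [hφt]
    nlinarith [sq_nonneg (e t)]

/-- A coupling kernel `Q + T` whose part `Q` contracts `d` on `G` and stays in `G` contracts some
bounded distance-like function, strictly so on the bounded parts of `G`. -/
theorem exists_contracting_distance {Y : Type*} [MeasurableSpace Y] {Q T : Y → Measure Y}
    {d : Y → ℝ} (hdm : Measurable d) (hd : ∀ z, 0 ≤ d z) {G : Set Y} (hGm : MeasurableSet G)
    (hQT : ∀ z, Q z univ + T z univ = 1) (hQG : ∀ z, Q z Gᶜ = 0)
    {α δ l ν : ℝ} (hα : α ∈ Ioo (0 : ℝ) 1) (hδ : 0 < δ) (hl : 0 < l) (hν : ν ∈ Ioc (0 : ℝ) 1)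
    (hcontr : ∀ z ∈ G, ∫⁻ w, ENNReal.ofReal (d w) ∂Q z ≤ ENNReal.ofReal (α * d z))
    (hmass : ∀ z ∈ G, T z univ ≤ ENNReal.ofReal (l * d z ^ ν))
    (hconc : ∀ z ∈ G, ENNReal.ofReal δ ≤ Q z {w | d w < α * d z}) :
    ∃ D : Y → ℝ≥0∞, Measurable D ∧ (∀ z, D z ≤ 1) ∧
      (∀ z, ∫⁻ w, D w ∂(Q z + T z) ≤ D z) ∧
      (∀ Δ : ℝ, 0 ≤ Δ → ∃ q ∈ Ioo (0 : ℝ) 1, ∀ z ∈ G, d z ≤ Δ →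
        ∫⁻ w, D w ∂(Q z + T z) ≤ ENNReal.ofReal q * D z) ∧
      ∃ A : ℝ, 0 < A ∧ ∀ z, ENNReal.ofReal (min 2 (d z)) ≤ ENNReal.ofReal A * D z := by
  classical
  obtain ⟨φ, e, N, q, A, hφm, hN, hq, hA, hφ, he, hanti, hsmall, hφe, hlarge⟩ :=
    exists_profile hα hδ hν
  obtain ⟨hα0, hα1⟩ := hα
  obtain ⟨hν0, hν1⟩ := hν
  set D : Y → ℝ≥0∞ := fun w => if w ∈ G then ENNReal.ofReal (φ (d w)) else 1 with hDdef
  have hDG : ∀ w ∈ G, D w = ENNReal.ofReal (φ (d w)) := fun w hw => if_pos hw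
  have hDG' : ∀ w ∉ G, D w = 1 := fun w hw => if_neg hw
  have hDm : Measurable D :=
    Measurable.ite hGm (hφm.comp hdm).ennreal_ofReal measurable_const
  have hD1 : ∀ z, D z ≤ 1 := fun z => by
    by_cases hz : z ∈ G
    · rw [hDG z hz]; exact ENNReal.ofReal_le_one.2 (hφ _ (hd z)).2.1
    · rw [hDG' z hz]
  have haeG : ∀ z, ∀ᵐ w ∂Q z, w ∈ G := fun z => mem_ae_iff.2 (hQG z)
  have hQ1 : ∀ z, Q z univ ≤ 1 := fun z => (hQT z) ▸ le_self_add
  have hT : ∀ z, ∫⁻ w, D w ∂T z ≤ T z univ := fun z =>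
    (lintegral_mono hD1).trans_eq lintegral_one
  have hnear : ∀ z ∈ G, N * d z ^ ν ≤ 1 →
      ∫⁻ w, D w ∂(Q z + T z) ≤ ENNReal.ofReal q * D z := fun z hz hzN => by
    have hdz : 0 ≤ d z ^ ν := Real.rpow_nonneg (hd z) _
    have hQint : ∫⁻ w, D w ∂Q z ≤ ENNReal.ofReal (N * (α ^ ν * d z ^ ν)) := by
      calc ∫⁻ w, D w ∂Q z
          ≤ ∫⁻ w, ENNReal.ofReal N * (ENNReal.ofReal (d w) ^ ν * 1 ^ (1 - ν)) ∂Q z := by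
            refine lintegral_mono_ae ?_
            filter_upwards [haeG z] with w hw
            rw [hDG w hw, ENNReal.one_rpow, mul_one,
              ENNReal.ofReal_rpow_of_nonneg (hd w) hν0.le, ← ENNReal.ofReal_mul hN.le]
            exact ENNReal.ofReal_le_ofReal (hφ _ (hd w)).2.2.1
        _ = ENNReal.ofReal N * ∫⁻ w, ENNReal.ofReal (d w) ^ ν * 1 ^ (1 - ν) ∂Q z :=
            lintegral_const_mul _ (by fun_prop)
        _ ≤ ENNReal.ofReal N *
              ((∫⁻ w, ENNReal.ofReal (d w) ∂Q z) ^ ν * (∫⁻ _, 1 ∂Q z) ^ (1 - ν)) := by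
            gcongr
            exact ENNReal.lintegral_mul_norm_pow_le hdm.ennreal_ofReal.aemeasurable
              aemeasurable_const hν0.le (by linarith) (by ring)
        _ ≤ ENNReal.ofReal N * (ENNReal.ofReal (α * d z) ^ ν * 1) := by
            gcongr
            · exact hcontr z hz
            · rw [lintegral_one]
              exact ENNReal.rpow_le_one (hQ1 z) (by linarith)
        _ = _ := by
            rw [mul_one, ENNReal.ofReal_rpow_of_nonneg (mul_nonneg hα0.le (hd z)) hν0.le,
              Real.mul_rpow hα0.le (hd z), ← ENNReal.ofReal_mul hN.le]
    calc ∫⁻ w, D w ∂(Q z + T z) = ∫⁻ w, D w ∂Q z + ∫⁻ w, D w ∂T z :=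
          lintegral_add_measure _ _ _
      _ ≤ ENNReal.ofReal (N * (α ^ ν * d z ^ ν)) + ENNReal.ofReal (l * d z ^ ν) :=
          add_le_add hQint ((hT z).trans (hmass z hz))
      _ = ENNReal.ofReal ((N * α ^ ν + l) * d z ^ ν) := by
          rw [← ENNReal.ofReal_add (by positivity) (by positivity)]
          congr 1; ring
      _ ≤ ENNReal.ofReal (q * φ (d z)) := ENNReal.ofReal_le_ofReal (hsmall _ (hd z) hzN)
      _ = _ := by rw [ENNReal.ofReal_mul hq.1.le, hDG z hz]
  have hfar : ∀ z ∈ G, 1 < N * d z ^ ν →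
      ∫⁻ w, D w ∂(Q z + T z) ≤ ENNReal.ofReal (1 - e (d z)) * D z := fun z hz hzN => by
    have hαz : 0 ≤ α * d z := mul_nonneg hα0.le (hd z)
    obtain ⟨hez0, hez1⟩ := he _ hαz
    set S : Set Y := {w | d w < α * d z} with hS
    have hSm : MeasurableSet S := measurableSet_lt hdm measurable_const
    have hsum : ∫⁻ w, D w ∂Q z + ENNReal.ofReal (e (α * d z)) * Q z S ≤ Q z univ := by
      rw [← lintegral_indicator_const hSm, ← lintegral_add_left hDm, ← lintegral_one]
      refine lintegral_mono_ae ?_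
      filter_upwards [haeG z] with w hw
      by_cases hwS : w ∈ S
      · rw [indicator_of_mem hwS, hDG w hw, ← ENNReal.ofReal_add (hφ _ (hd w)).1 hez0.le]
        exact ENNReal.ofReal_le_one.2
          (by linarith [hφe _ hαz _ (hd w) (le_of_lt hwS)])
      · rw [indicator_of_notMem hwS, add_zero]; exact hD1 w
    have htot : ∫⁻ w, D w ∂(Q z + T z) + ENNReal.ofReal (δ * e (α * d z)) ≤ 1 := by
      calc ∫⁻ w, D w ∂(Q z + T z) + ENNReal.ofReal (δ * e (α * d z))
          ≤ (∫⁻ w, D w ∂Q z + ∫⁻ w, D w ∂T z) + ENNReal.ofReal (e (α * d z)) * Q z S := by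
            rw [lintegral_add_measure, ENNReal.ofReal_mul hδ.le,
              mul_comm (ENNReal.ofReal δ)]
            gcongr
            exact hconc z hz
        _ = (∫⁻ w, D w ∂Q z + ENNReal.ofReal (e (α * d z)) * Q z S) + ∫⁻ w, D w ∂T z := by
            ring
        _ ≤ Q z univ + T z univ := add_le_add hsum (hT z)
        _ = 1 := hQT z
    calc ∫⁻ w, D w ∂(Q z + T z) ≤ 1 - ENNReal.ofReal (δ * e (α * d z)) :=
          ENNReal.le_sub_of_add_le_right ENNReal.ofReal_ne_top htot
      _ = ENNReal.ofReal (1 - δ * e (α * d z)) := by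
          rw [ENNReal.ofReal_sub _ (by positivity), ENNReal.ofReal_one]
      _ ≤ ENNReal.ofReal ((1 - e (d z)) * φ (d z)) :=
          ENNReal.ofReal_le_ofReal (hlarge _ (hd z) hzN)
      _ = _ := by rw [ENNReal.ofReal_mul (by linarith [(he _ (hd z)).2]), hDG z hz]
  have hlocal : ∀ Δ : ℝ, 0 ≤ Δ → ∃ q ∈ Ioo (0 : ℝ) 1, ∀ z ∈ G, d z ≤ Δ →
      ∫⁻ w, D w ∂(Q z + T z) ≤ ENNReal.ofReal q * D z := fun Δ hΔ => by
    obtain ⟨heΔ0, heΔ1⟩ := he Δ hΔ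
    refine ⟨max q (1 - e Δ), ⟨lt_max_of_lt_left hq.1, max_lt hq.2 (by linarith)⟩,
      fun z hz hzΔ => ?_⟩
    rcases le_or_gt (N * d z ^ ν) 1 with h | h
    · refine (hnear z hz h).trans ?_
      gcongr
      exact le_max_left _ _
    · refine (hfar z hz h).trans ?_
      gcongr
      exact (by linarith [hanti (hd z) hΔ hzΔ] : 1 - e (d z) ≤ 1 - e Δ).trans (le_max_right _ _)
  refine ⟨D, hDm, hD1, fun z => ?_, hlocal, max A 2, lt_max_of_lt_left hA, fun z => ?_⟩
  · by_cases hz : z ∈ G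
    · obtain ⟨p, hp, h⟩ := hlocal (d z) (hd z)
      exact (h z hz le_rfl).trans (mul_le_of_le_one_left' (ENNReal.ofReal_le_one.2 hp.2.le))
    · rw [hDG' z hz, ← hQT z, ← Measure.add_apply, ← lintegral_one]
      exact lintegral_mono hD1
  · by_cases hz : z ∈ G
    · rw [hDG z hz, ← ENNReal.ofReal_mul (lt_max_of_lt_left hA).le]
      refine ENNReal.ofReal_le_ofReal ((hφ _ (hd z)).2.2.2.trans ?_)
      exact mul_le_mul_of_nonneg_right (le_max_left _ _) (hφ _ (hd z)).1
    · rw [hDG' z hz, mul_one]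
      exact ENNReal.ofReal_le_ofReal ((min_le_left _ _).trans (le_max_right _ _))

end Distance

/-! ### Exponential moments of hitting times -/

section Hitting

variable {Y : Type*}

open Classical in
/-- `hitWeight K a n ω = a ^ min n κ`, with `κ` the hitting time of `K` by the path `ω`. -/
def hitWeight (K : Set Y) (a : ℝ≥0∞) : ℕ → (ℕ → Y) → ℝ≥0∞
  | 0, _ => 1
  | n + 1, ω => if ω 0 ∈ K then 1 else a * hitWeight K a n (fun k => ω (k + 1))

lemma one_le_hitWeight (K : Set Y) {a : ℝ≥0∞} (ha : 1 ≤ a) (n : ℕ) (ω : ℕ → Y) :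
    1 ≤ hitWeight K a n ω := by
  induction n generalizing ω with
  | zero => exact le_rfl
  | succ n ih =>
    rw [hitWeight]
    split_ifs
    · exact le_rfl
    · exact one_le_mul ha (ih _)

lemma hitWeight_le_succ (K : Set Y) {a : ℝ≥0∞} (ha : 1 ≤ a) (n : ℕ) (ω : ℕ → Y) :
    hitWeight K a n ω ≤ hitWeight K a (n + 1) ω := by
  induction n generalizing ω with
  | zero => exact one_le_hitWeight K ha 1 ω
  | succ n ih =>
    rw [hitWeight, hitWeight]
    split_ifs
    · exact le_rfl
    · gcongr; exact ih _

lemma hitWeight_mono (K : Set Y) {a b : ℝ≥0∞} (hab : a ≤ b) (n : ℕ) (ω : ℕ → Y) :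
    hitWeight K a n ω ≤ hitWeight K b n ω := by
  induction n generalizing ω with
  | zero => exact le_rfl
  | succ n ih =>
    rw [hitWeight, hitWeight]
    split_ifs
    · exact le_rfl
    · gcongr; exact ih _

lemma hitWeight_le_pow {K : Set Y} {a : ℝ≥0∞} (ha : 1 ≤ a) {ω : ℕ → Y} {k : ℕ} (hk : ω k ∈ K)
    (n : ℕ) : hitWeight K a n ω ≤ a ^ k := by
  induction n generalizing ω k with
  | zero => exact one_le_pow_of_one_le' ha k
  | succ n ih =>
    rw [hitWeight]
    split_ifs with h
    · exact one_le_pow_of_one_le' ha k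
    · cases k with
      | zero => exact absurd hk h
      | succ k =>
        rw [pow_succ']
        gcongr
        exact ih hk

lemma hitWeight_le_geomInv {K S : Set Y} (hSK : S ⊆ K) {β : ℝ} (hβ : β ∈ Ioo (0 : ℝ) 1) (n : ℕ)
    (ω : ℕ → Y) :
    hitWeight K (ENNReal.ofReal β⁻¹) n ω ≤ geomInv β (⨅ k ∈ {k : ℕ | ω k ∈ S}, (k : ℕ∞)) := by
  by_cases h : ∃ k, ω k ∈ S
  · classical
    have hmin : (⨅ k ∈ {k : ℕ | ω k ∈ S}, (k : ℕ∞)) = (Nat.find h : ℕ) :=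
      le_antisymm (iInf₂_le (Nat.find h) (Nat.find_spec h))
        (le_iInf₂ fun k hk => Nat.cast_le.2 (Nat.find_min' h hk))
    rw [hmin, geomInv, if_neg (ENat.natCast_ne_top _), ENat.toNat_natCast,
      ENNReal.ofReal_pow (inv_nonneg.2 hβ.1.le)]
    exact hitWeight_le_pow (ENNReal.one_le_ofReal.2 ((one_le_inv₀ hβ.1).2 hβ.2.le))
      (hSK (Nat.find_spec h)) n
  · push Not at h
    have : (⨅ k ∈ {k : ℕ | ω k ∈ S}, (k : ℕ∞)) = ⊤ := by simp [h]
    rw [this, geomInv, if_pos rfl]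
    exact le_top

variable [MeasurableSpace Y] {B : Y → Measure Y} {Bpath : Y → Measure (ℕ → Y)}

lemma measurable_prepend (z : Y) : Measurable (prepend z) := by
  refine measurable_pi_lambda _ fun n => ?_
  cases n with
  | zero => exact measurable_const
  | succ n => exact measurable_pi_apply n

lemma measurable_hitWeight {K : Set Y} (hK : MeasurableSet K) (a : ℝ≥0∞) (n : ℕ) :
    Measurable (hitWeight K a n) := by
  induction n with
  | zero => exact measurable_const
  | succ n ih =>
    refine Measurable.ite (measurable_pi_apply 0 hK) measurable_const (measurable_const.mul ?_)
    exact ih.comp (measurable_pi_lambda _ fun k => measurable_pi_apply (k + 1))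

lemma lintegral_hitWeight_succ_of_notMem (hBmeas : Measurable Bpath)
    (hBrec : ∀ z, Bpath z = ((B z).bind Bpath).map (prepend z)) {K : Set Y}
    (hK : MeasurableSet K) (a : ℝ≥0∞) (n : ℕ) {z : Y} (hz : z ∉ K) :
    ∫⁻ ω, hitWeight K a (n + 1) ω ∂Bpath z
      = a * ∫⁻ w, ∫⁻ ω, hitWeight K a n ω ∂Bpath w ∂B z := by
  have hm := measurable_hitWeight hK a n
  rw [hBrec z, lintegral_map (measurable_hitWeight hK a _) (measurable_prepend z)]
  have hshift : ∀ ω, hitWeight K a (n + 1) (prepend z ω) = a * hitWeight K a n ω :=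
    fun ω => if_neg hz
  simp_rw [hshift]
  rw [lintegral_const_mul _ hm, Measure.lintegral_bind hBmeas.aemeasurable hm.aemeasurable]

lemma lintegral_hitWeight_of_mem [∀ z, IsProbabilityMeasure (Bpath z)]
    [∀ z, IsProbabilityMeasure (B z)] (hBmeas : Measurable Bpath)
    (hBrec : ∀ z, Bpath z = ((B z).bind Bpath).map (prepend z)) {K : Set Y}
    (hK : MeasurableSet K) (a : ℝ≥0∞) (n : ℕ) {z : Y} (hz : z ∈ K) :
    ∫⁻ ω, hitWeight K a n ω ∂Bpath z = 1 := by
  cases n with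
  | zero => simp [hitWeight]
  | succ n =>
    rw [hBrec z, lintegral_map (measurable_hitWeight hK a _) (measurable_prepend z)]
    have hone : ∀ ω, hitWeight K a (n + 1) (prepend z ω) = 1 := fun ω => if_pos hz
    simp_rw [hone]
    rw [Measure.lintegral_bind hBmeas.aemeasurable aemeasurable_const]
    simp

/-- A Lyapunov function for `B` from exponential moments of the hitting time of `K`, known only
on a sublevel set of `U`, and a drift condition on `U`. -/
theorem exists_hitting_lyapunov [∀ z, IsProbabilityMeasure (Bpath z)]
    [∀ z, IsProbabilityMeasure (B z)] (hBmeas : Measurable Bpath)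
    (hBrec : ∀ z, Bpath z = ((B z).bind Bpath).map (prepend z))
    {U : Y → ℝ} (hUm : Measurable U) (hU : ∀ z, 0 ≤ U z) {lam c : ℝ} (hlam : lam ∈ Ioo (0 : ℝ) 1)
    (hc : 0 < c)
    (hdrift : ∀ z, ∫⁻ w, ENNReal.ofReal (U w) ∂B z ≤ ENNReal.ofReal (lam * U z + 2 * c))
    {F : Set Y} {K : Set Y} (hK : MeasurableSet K) {β Ctil R : ℝ} (hβ : β ∈ Ioo (0 : ℝ) 1)
    (hFK : F ⊆ K) (hKU : ∀ z ∈ K, U z ≤ R)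
    (hmom : ∀ z, U z < 4 * c / (1 - lam) →
      ∫⁻ ω, geomInv β (⨅ n ∈ {n : ℕ | ω n ∈ F}, (n : ℕ∞)) ∂(Bpath z) ≤ ENNReal.ofReal Ctil) :
    ∃ (H : Y → ℝ≥0∞) (s C : ℝ), Measurable H ∧ s ∈ Ioo (0 : ℝ) 1 ∧ 0 < C ∧ (∀ z, 1 ≤ H z) ∧
      (∀ z, H z ≤ ENNReal.ofReal (C * (U z + 1))) ∧
      (∀ z ∈ K, ∫⁻ w, H w ∂B z ≤ ENNReal.ofReal (C * (lam * R + 2 * c + 1))) ∧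
      (∀ z ∉ K, ∫⁻ w, H w ∂B z ≤ ENNReal.ofReal s * H z) := by
  obtain ⟨hl0, hl1⟩ := hlam
  set t : ℝ := 4 * c / (1 - lam) with ht
  have ht0 : 0 < t := div_pos (by linarith) (by linarith)
  have hct : t * (1 - lam) = 4 * c := div_mul_cancel₀ _ (by linarith)
  set p : ℝ := ((1 + lam) / 2 * t + 1) / (t + 1) with hp
  have hp1 : p < 1 := by
    rw [hp, div_lt_one (by linarith)]; nlinarith
  have hpt : p * (t + 1) = (1 + lam) / 2 * t + 1 := div_mul_cancel₀ _ (by linarith)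
  have hpl : (1 + lam) / 2 ≤ p := by
    rw [hp, le_div_iff₀ (by linarith)]; nlinarith
  have hpU : ∀ u, t ≤ u → lam * u + 2 * c + 1 ≤ p * (u + 1) := fun u hu => by
    nlinarith [mul_nonneg (sub_nonneg.2 hpl) (sub_nonneg.2 hu)]
  set s : ℝ := max β p with hs
  have hs0 : 0 < s := lt_max_of_lt_left hβ.1
  have hs1 : s < 1 := max_lt hβ.2 hp1
  set a : ℝ≥0∞ := ENNReal.ofReal s⁻¹ with ha
  have ha1 : 1 ≤ a := ENNReal.one_le_ofReal.2 ((one_le_inv₀ hs0).2 hs1.le)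
  have hsa : ENNReal.ofReal s * a = 1 := by
    rw [ha, ← ENNReal.ofReal_mul hs0.le, mul_inv_cancel₀ hs0.ne', ENNReal.ofReal_one]
  set C : ℝ := max 1 Ctil with hC
  have hC1 : 1 ≤ C := le_max_left _ _
  have hC0 : 0 < C := by linarith
  set h : ℕ → Y → ℝ≥0∞ := fun n z => ∫⁻ ω, hitWeight K a n ω ∂Bpath z with hh
  have hhm : ∀ n, Measurable (h n) := fun n =>
    (Measure.measurable_lintegral (measurable_hitWeight hK a n)).comp hBmeas
  have hmono : Monotone h := monotone_nat_of_le_succ fun n z =>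
    lintegral_mono fun ω => hitWeight_le_succ K ha1 n ω
  have hsucc : ∀ n, ∀ z ∉ K, h (n + 1) z = a * ∫⁻ w, h n w ∂B z := fun n z hz =>
    lintegral_hitWeight_succ_of_notMem hBmeas hBrec hK a n hz
  have hmem : ∀ n, ∀ z ∈ K, h n z = 1 := fun n z hz =>
    lintegral_hitWeight_of_mem hBmeas hBrec hK a n hz
  have hone : ∀ z, 1 ≤ C * (U z + 1) := fun z =>
    one_le_mul_of_one_le_of_one_le hC1 (by linarith [hU z])
  have hbound : ∀ g : Y → ℝ≥0∞, (∀ z, g z ≤ ENNReal.ofReal (C * (U z + 1))) → ∀ z,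
      ∫⁻ w, g w ∂B z ≤ ENNReal.ofReal (C * (lam * U z + 2 * c + 1)) := fun g hg z => by
    have hlU : 0 ≤ lam * U z := mul_nonneg hl0.le (hU z)
    calc ∫⁻ w, g w ∂B z ≤ ∫⁻ w, ENNReal.ofReal C * (ENNReal.ofReal (U w) + 1) ∂B z := by
          refine lintegral_mono fun w => (hg w).trans_eq ?_
          rw [ENNReal.ofReal_mul hC0.le, ENNReal.ofReal_add (hU w) zero_le_one,
            ENNReal.ofReal_one]
      _ = ENNReal.ofReal C * (∫⁻ w, ENNReal.ofReal (U w) ∂B z + 1) := by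
          rw [lintegral_const_mul _ (by fun_prop), lintegral_add_right _ measurable_const]
          simp
      _ ≤ ENNReal.ofReal C * (ENNReal.ofReal (lam * U z + 2 * c) + 1) := by
          gcongr; exact hdrift z
      _ = _ := by
          rw [ENNReal.ofReal_mul hC0.le, ENNReal.ofReal_add (by linarith) zero_le_one,
            ENNReal.ofReal_one]
  have hle : ∀ n z, h n z ≤ ENNReal.ofReal (C * (U z + 1)) := fun n => by
    induction n with
    | zero =>
      intro z
      simpa [hh, hitWeight] using hone z
    | succ n ih =>
      intro z
      by_cases hz : z ∈ K
      · rw [hmem _ z hz]; exact ENNReal.one_le_ofReal.2 (hone z)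
      rcases lt_or_ge (U z) t with hzt | hzt
      · calc h (n + 1) z ≤ ∫⁻ ω, geomInv β (⨅ n ∈ {n : ℕ | ω n ∈ F}, (n : ℕ∞)) ∂(Bpath z) := by
              refine lintegral_mono fun ω => (hitWeight_mono K ?_ _ ω).trans
                (hitWeight_le_geomInv hFK hβ (n + 1) ω)
              exact ENNReal.ofReal_le_ofReal (inv_anti₀ hβ.1 (le_max_left _ _))
          _ ≤ ENNReal.ofReal Ctil := hmom z hzt
          _ ≤ _ := ENNReal.ofReal_le_ofReal ((le_max_right 1 Ctil).trans
              (le_mul_of_one_le_right hC0.le (by linarith [hU z])))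
      · calc h (n + 1) z = a * ∫⁻ w, h n w ∂B z := hsucc n z hz
          _ ≤ a * ENNReal.ofReal (C * (lam * U z + 2 * c + 1)) := by
              gcongr; exact hbound _ ih z
          _ ≤ a * ENNReal.ofReal (s * (C * (U z + 1))) := by
              gcongr a * ENNReal.ofReal ?_
              have h1 : p * (U z + 1) ≤ s * (U z + 1) :=
                mul_le_mul_of_nonneg_right (le_max_right _ _) (by linarith [hU z])
              calc C * (lam * U z + 2 * c + 1) ≤ C * (s * (U z + 1)) :=
                    mul_le_mul_of_nonneg_left ((hpU _ hzt).trans h1) hC0.le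
                _ = _ := by ring
          _ = _ := by rw [ENNReal.ofReal_mul hs0.le, ← mul_assoc, mul_comm a, hsa, one_mul]
  have hH : ∀ z, ⨆ n, h n z ≤ ENNReal.ofReal (C * (U z + 1)) := fun z => iSup_le fun n => hle n z
  refine ⟨fun z => ⨆ n, h n z, s, C, Measurable.iSup hhm, ⟨hs0, hs1⟩, hC0, fun z => ?_, hH,
    fun z hz => ?_, fun z hz => ?_⟩
  · exact le_iSup_of_le 0 (by simp [hh, hitWeight])
  · refine (hbound _ hH z).trans (ENNReal.ofReal_le_ofReal ?_)
    gcongr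
    exact hKU z hz
  · rw [lintegral_iSup hhm hmono]
    refine iSup_le fun n => ?_
    calc ∫⁻ w, h n w ∂B z = ENNReal.ofReal s * h (n + 1) z := by
          rw [hsucc n z hz, ← mul_assoc, hsa, one_mul]
      _ ≤ _ := by gcongr; exact le_iSup (fun n => h n z) (n + 1)

end Hitting

/-! ### Iterates of the Markov operator -/

section Iterates

variable {X : Type*} [MeasurableSpace X] {P : Kernel X X}

/-- The action of the kernel `P` on functions. -/
def markovOp (P : Kernel X X) (g : X → ℝ) (x : X) : ℝ := ∫ y, g y ∂P x

lemma measurable_markovOp [IsSFiniteKernel P] {g : X → ℝ} (hg : Measurable g) :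
    Measurable (markovOp P g) :=
  hg.stronglyMeasurable.integral_kernel.measurable

lemma measurable_markovOp_iterate [IsSFiniteKernel P] {g : X → ℝ} (hg : Measurable g)
    (n : ℕ) : Measurable ((markovOp P)^[n] g) := by
  induction n with
  | zero => exact hg
  | succ n ih => rw [Function.iterate_succ_apply']; exact measurable_markovOp ih

variable [IsMarkovKernel P]

lemma abs_markovOp_le {g : X → ℝ} {M : ℝ} (hM : ∀ x, |g x| ≤ M) (x : X) :
    |markovOp P g x| ≤ M := by
  simpa [markovOp] using norm_integral_le_of_norm_le_const (μ := P x)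
    (ae_of_all _ fun y => (Real.norm_eq_abs _).trans_le (hM y))

lemma abs_markovOp_iterate_le {g : X → ℝ} {M : ℝ} (hM : ∀ x, |g x| ≤ M) (n : ℕ) (x : X) :
    |(markovOp P)^[n] g x| ≤ M := by
  induction n generalizing x with
  | zero => exact hM x
  | succ n ih => rw [Function.iterate_succ_apply']; exact abs_markovOp_le ih x

lemma integrable_of_abs_le {Y : Type*} [MeasurableSpace Y] {μ : Measure Y} [IsFiniteMeasure μ]
    {g : Y → ℝ} (hg : Measurable g) {M : ℝ} (hM : ∀ x, |g x| ≤ M) : Integrable g μ :=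
  Integrable.of_bound hg.aestronglyMeasurable M (ae_of_all _ hM)

lemma integral_iterate_bind (μ : Measure X) [IsProbabilityMeasure μ] {g : X → ℝ}
    (hg : Measurable g) {M : ℝ} (hM : ∀ x, |g x| ≤ M) (n : ℕ) :
    ∫ x, g x ∂((fun m : Measure X => m.bind ⇑P)^[n] μ) = ∫ x, (markovOp P)^[n] g x ∂μ := by
  induction n generalizing μ with
  | zero => rfl
  | succ n ih =>
    have : IsProbabilityMeasure (μ.bind ⇑P) :=
      isProbabilityMeasure_bind P.aemeasurable (ae_of_all _ fun x => inferInstance)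
    rw [Function.iterate_succ_apply, ih (μ.bind ⇑P), Function.iterate_succ_apply']
    rw [Measure.comp_eq_comp_const_apply, Kernel.integral_comp]
    · rfl
    · exact integrable_of_abs_le (measurable_markovOp_iterate hg n) (abs_markovOp_iterate_le hM n)

/-- A coupling that contracts a weight `V` contracts the oscillation bounded by `V`. -/
lemma abs_markovOp_iterate_sub_le {B : X × X → Measure (X × X)}
    (hfst : ∀ z, (B z).fst = P z.1) (hsnd : ∀ z, (B z).snd = P z.2)
    {V : X × X → ℝ≥0∞} (hV : Measurable V) {ρ : ℝ≥0∞}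
    (hB : ∀ z, ∫⁻ w, V w ∂B z ≤ ρ * V z) {A : ℝ≥0∞} {g : X → ℝ} (hg : Measurable g) {M : ℝ}
    (hM : ∀ x, |g x| ≤ M) (hgV : ∀ z : X × X, ENNReal.ofReal |g z.1 - g z.2| ≤ A * V z)
    (n : ℕ) (z : X × X) :
    ENNReal.ofReal |(markovOp P)^[n] g z.1 - (markovOp P)^[n] g z.2| ≤ A * (ρ ^ n * V z) := by
  induction n generalizing z with
  | zero => simpa using hgV z
  | succ n ih =>
    rw [Function.iterate_succ_apply']
    set f := (markovOp P)^[n] g with hf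
    have hfm : Measurable f := measurable_markovOp_iterate hg n
    have hfM : ∀ x, |f x| ≤ M := abs_markovOp_iterate_le hM n
    have : IsProbabilityMeasure (B z) :=
      ⟨by rw [← Measure.fst_univ, hfst z, measure_univ]⟩
    have h1 : markovOp P f z.1 = ∫ w, f w.1 ∂B z := by
      rw [markovOp, ← hfst z, Measure.fst,
        integral_map measurable_fst.aemeasurable hfm.aestronglyMeasurable]
    have h2 : markovOp P f z.2 = ∫ w, f w.2 ∂B z := by
      rw [markovOp, ← hsnd z, Measure.snd,
        integral_map measurable_snd.aemeasurable hfm.aestronglyMeasurable]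
    have i1 : Integrable (fun w : X × X => f w.1) (B z) :=
      integrable_of_abs_le (hfm.comp measurable_fst) fun w => hfM w.1
    have i2 : Integrable (fun w : X × X => f w.2) (B z) :=
      integrable_of_abs_le (hfm.comp measurable_snd) fun w => hfM w.2
    rw [h1, h2, ← integral_sub i1 i2]
    calc ENNReal.ofReal |∫ w, (f w.1 - f w.2) ∂B z|
        ≤ ∫⁻ w, ENNReal.ofReal |f w.1 - f w.2| ∂B z := by
          simpa only [← ofReal_norm, Real.norm_eq_abs] using
            enorm_integral_le_lintegral_enorm (μ := B z) fun w : X × X => f w.1 - f w.2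
      _ ≤ ∫⁻ w, A * (ρ ^ n * V w) ∂B z := lintegral_mono ih
      _ = A * (ρ ^ n * ∫⁻ w, V w ∂B z) := by
          rw [lintegral_const_mul _ (hV.const_mul _), lintegral_const_mul _ hV]
      _ ≤ A * (ρ ^ n * (ρ * V z)) := by gcongr; exact hB z
      _ = A * (ρ ^ (n + 1) * V z) := by rw [pow_succ, mul_assoc]

end Iterates

lemma measure_compl_measSupport {X : Type*} [TopologicalSpace X] [SecondCountableTopology X]
    [MeasurableSpace X] (μ : Measure X) : μ (measSupport μ)ᶜ = 0 := by
  refine measure_null_of_locally_null _ fun x hx => ?_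
  simp only [measSupport, mem_compl_iff, mem_ofPred_eq, not_forall, not_lt,
    nonpos_iff_eq_zero] at hx
  obtain ⟨U, hU, hxU, h0⟩ := hx
  exact ⟨U, mem_nhdsWithin_of_mem_nhds (hU.mem_nhds hxU), h0⟩

theorem pointwise_exponential_rate
    {X : Type*} [MetricSpace X] [CompleteSpace X] [SecondCountableTopology X]
    [MeasurableSpace X] [BorelSpace X]
    -- the Markov operator, given through its transition probability function
    (P : Kernel X X) [IsMarkovKernel P]
    -- the family Q_{x,y} of subprobability measures with marginals dominated by P_x, P_y
    (Q : Kernel (X × X) (X × X))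
    (hQsub : ∀ z : X × X, Q z Set.univ ≤ 1)
    (hQfst : ∀ z : X × X, (Q z).fst ≤ P z.1)
    (hQsnd : ∀ z : X × X, (Q z).snd ≤ P z.2)
    -- A0 : P is a Feller operator
    (hFeller : ∀ f : X → ℝ, Continuous f → (∃ M, ∀ x, |f x| ≤ M) →
      Continuous (fun x => ∫ y, f y ∂P x))
    -- A1 : there is a Lyapunov function L for P
    (L : X → ℝ) (hLcont : Continuous L) (hLnonneg : ∀ x, 0 ≤ L x)
    (hLbdd : ∀ s : Set X, Bornology.IsBounded s → BddAbove (L '' s))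
    (hLinf : Tendsto L (Bornology.cobounded X) atTop)
    (lam c : ℝ) (hlam : lam ∈ Set.Ioo (0:ℝ) 1) (hc : 0 < c)
    (hLyap : ∀ x, ∫⁻ y, ENNReal.ofReal (L y) ∂P x ≤ ENNReal.ofReal (lam * L x + c))
    -- A2 : contractivity of Q on F
    (F : Set (X × X)) (α : ℝ) (hα : α ∈ Set.Ioo (0:ℝ) 1)
    (hsupp : ∀ z : X × X, measSupport (Q z) ⊆ F)
    (hcontr : ∀ z ∈ F, ∫⁻ w : X × X, ENNReal.ofReal (dist w.1 w.2) ∂Q z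
        ≤ ENNReal.ofReal (α * dist z.1 z.2))
    -- A3 : mass of Q and concentration near the diagonal
    (δ l ν : ℝ) (hδ : 0 < δ) (hl : 0 < l) (hν : ν ∈ Set.Ioc (0:ℝ) 1)
    (hmass : ∀ z ∈ F, 1 - (Q z Set.univ).toReal ≤ l * dist z.1 z.2 ^ ν)
    (hconc : ∀ z ∈ F, ENNReal.ofReal δ ≤ Q z {w : X × X | dist w.1 w.2 < α * dist z.1 z.2})
    -- A4 : for the Markov chain on X² with transition function B_{x,y} = Q_{x,y} + R_{x,y},
    -- given by its pathspace measures `Bpath`, the hitting time κ of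
    -- {(x,y) ∈ F : L x + L y < R} has exponential moments
    (Bpath : X × X → Measure (ℕ → X × X))
    (hBmeas : Measurable Bpath)
    (hBprob : ∀ z, IsProbabilityMeasure (Bpath z))
    (hBrec : ∀ z, Bpath z = ((Bpart P Q z).bind Bpath).map (prepend z))
    (β Ctil R : ℝ) (hβ : β ∈ Set.Ioo (0:ℝ) 1) (hCtil : 0 < Ctil) (hR : 0 < R)
    (hA4 : ∀ z : X × X, L z.1 + L z.2 < 4 * c / (1 - lam) →
      ∫⁻ ω, geomInv β
          (⨅ n ∈ {n : ℕ | ω n ∈ F ∧ L (ω n).1 + L (ω n).2 < R}, (n : ℕ∞)) ∂(Bpath z)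
        ≤ ENNReal.ofReal Ctil) :
    -- conclusion: exponential closeness of trajectories started at x and at y
    ∃ q C : ℝ, q ∈ Set.Ioo (0:ℝ) 1 ∧ 0 < C ∧
      ∀ x y : X, ∀ n : ℕ,
        fmDist ((fun m : Measure X => m.bind ⇑P)^[n] (Measure.dirac x))
            ((fun m : Measure X => m.bind ⇑P)^[n] (Measure.dirac y))
          ≤ q ^ n * C * (L x + L y + 1) := by
  have hQfin : ∀ z, IsFiniteMeasure (Q z) := fun z => ⟨(hQsub z).trans_lt ENNReal.one_lt_top⟩
  have hQk : IsFiniteKernel Q := ⟨1, ENNReal.one_lt_top, hQsub⟩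
  have hBp : ∀ z, IsProbabilityMeasure (Bpart P Q z) := fun z =>
    isProbabilityMeasure_Bpart (hQfst z) (hQsnd z)
  have hfst : ∀ z, (Bpart P Q z).fst = P z.1 := fun z => Bpart_fst (hQfst z) (hQsnd z)
  have hsnd : ∀ z, (Bpart P Q z).snd = P z.2 := fun z => Bpart_snd (hQfst z) (hQsnd z)
  set d : X × X → ℝ := fun w => dist w.1 w.2 with hd
  have hdm : Measurable d := measurable_dist
  set U : X × X → ℝ := fun w => L w.1 + L w.2 with hU
  have hLm : Measurable L := hLcont.measurable
  have hUm : Measurable U := by fun_prop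
  have hU0 : ∀ z, 0 ≤ U z := fun z => add_nonneg (hLnonneg _) (hLnonneg _)
  have hdrift : ∀ z, ∫⁻ w, ENNReal.ofReal (U w) ∂Bpart P Q z
      ≤ ENNReal.ofReal (lam * U z + 2 * c) := fun z => by
    have hL : ∀ x, 0 ≤ lam * L x + c := fun x =>
      add_nonneg (mul_nonneg hlam.1.le (hLnonneg x)) hc.le
    calc ∫⁻ w, ENNReal.ofReal (U w) ∂Bpart P Q z
        = ∫⁻ w, ENNReal.ofReal (L w.1) ∂Bpart P Q z
            + ∫⁻ w, ENNReal.ofReal (L w.2) ∂Bpart P Q z := by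
          rw [← lintegral_add_left (by fun_prop)]
          exact lintegral_congr fun w => ENNReal.ofReal_add (hLnonneg _) (hLnonneg _)
      _ = ∫⁻ x, ENNReal.ofReal (L x) ∂P z.1 + ∫⁻ x, ENNReal.ofReal (L x) ∂P z.2 := by
          rw [← hfst z, ← hsnd z, Measure.fst, Measure.snd,
            lintegral_map (by fun_prop) measurable_fst, lintegral_map (by fun_prop) measurable_snd]
      _ ≤ ENNReal.ofReal (lam * L z.1 + c) + ENNReal.ofReal (lam * L z.2 + c) :=
          add_le_add (hLyap _) (hLyap _)
      _ = _ := by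
          rw [← ENNReal.ofReal_add (hL _) (hL _)]
          congr 1; simp only [hU]; ring
  -- `F` need not be measurable: replace it by the measurable set where its properties hold
  set G : Set (X × X) := {z | ∫⁻ w, ENNReal.ofReal (d w) ∂Q z ≤ ENNReal.ofReal (α * d z) ∧
    1 - (Q z univ).toReal ≤ l * d z ^ ν ∧ ENNReal.ofReal δ ≤ Q z {w | d w < α * d z}} with hG
  have hFG : F ⊆ G := fun z hz => ⟨hcontr z hz, hmass z hz, hconc z hz⟩
  have hGm : MeasurableSet G := by
    have h₁ : Measurable fun z => ∫⁻ w, ENNReal.ofReal (d w) ∂Q z :=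
      hdm.ennreal_ofReal.lintegral_kernel
    have h₂ : Measurable fun z => (Q z univ).toReal :=
      (Q.measurable_coe MeasurableSet.univ).ennreal_toReal
    have h₃ : Measurable fun z => Q z {w | d w < α * d z} :=
      Kernel.measurable_kernel_prodMk_left (κ := Q)
        (t := {p : (X × X) × (X × X) | d p.2 < α * d p.1})
        (measurableSet_lt (hdm.comp measurable_snd) ((hdm.comp measurable_fst).const_mul α))
    exact (measurableSet_le h₁ (by fun_prop)).inter ((measurableSet_le (h₂.const_sub 1)
      (by fun_prop)).inter (measurableSet_le measurable_const h₃))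
  have hQG : ∀ z, Q z Gᶜ = 0 := fun z =>
    measure_mono_null (compl_subset_compl.2 ((hsupp z).trans hFG)) (measure_compl_measSupport _)
  have hQT : ∀ z, Q z univ + Rpart P Q z univ = 1 := fun z => by
    rw [Rpart_univ (hQfst z) (hQsnd z), add_tsub_cancel_of_le (hQsub z)]
  have hRmass : ∀ z ∈ G, Rpart P Q z univ ≤ ENNReal.ofReal (l * d z ^ ν) := fun z hz => by
    rw [Rpart_univ (hQfst z) (hQsnd z), ← ENNReal.ofReal_toReal (measure_ne_top (Q z) univ),
      ← ENNReal.ofReal_one, ← ENNReal.ofReal_sub _ ENNReal.toReal_nonneg]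
    exact ENNReal.ofReal_le_ofReal hz.2.1
  obtain ⟨D, hDm, hD1, hDB, hDloc, A, hA, hAD⟩ :=
    exists_contracting_distance hdm (fun _ => dist_nonneg) hGm hQT hQG hα hδ hl hν
      (fun z hz => hz.1) hRmass (fun z hz => hz.2.2)
  set K : Set (X × X) := {z | z ∈ G ∧ U z < R} with hK
  have hKm : MeasurableSet K := hGm.inter (measurableSet_lt hUm measurable_const)
  obtain ⟨H, s, C, hHm, hs, hC, hH1, hHU, hHK, hHoff⟩ :=
    exists_hitting_lyapunov hBmeas hBrec hUm hU0 hlam hc hdrift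
      (F := {z | z ∈ F ∧ U z < R}) hKm hβ (fun z hz => ⟨hFG hz.1, hz.2⟩)
      (fun z hz => hz.2.le) hA4
  have hbdd : Bornology.IsBounded {x | L x < R} := by
    rw [← Bornology.isCobounded_compl_iff]
    filter_upwards [hLinf.eventually_ge_atTop R] with x hx using not_lt.2 hx
  obtain ⟨q, hq, hDK⟩ := hDloc (Metric.diam {x | L x < R}) Metric.diam_nonneg
  have hKd : ∀ z ∈ K, d z ≤ Metric.diam {x | L x < R} := fun z hz => by
    have hz2 : L z.1 + L z.2 < R := hz.2
    exact Metric.dist_le_diam_of_mem hbdd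
      (by simp only [mem_ofPred_eq]; linarith [hLnonneg z.2])
      (by simp only [mem_ofPred_eq]; linarith [hLnonneg z.1])
  have hM : 0 < C * (lam * R + 2 * c + 1) := by
    have := mul_pos hlam.1 hR
    positivity
  obtain ⟨ρ, η, hρ, hη, hV⟩ := exists_harrisWeight_contraction (Bpart P Q) hDm hHm hq hs hM hDB
    (fun z hz => hDK z hz.1 (hKd z hz)) hH1 hHK hHoff
  have hVm : Measurable (harrisWeight D H η) := by unfold harrisWeight; fun_prop
  have hDV : ∀ z, D z ≤ harrisWeight D H η z := fun z =>
    calc D z = D z ^ (1 : ℝ) := (ENNReal.rpow_one _).symm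
      _ ≤ D z ^ (1 / 2 : ℝ) := ENNReal.rpow_le_rpow_of_exponent_ge (hD1 z) (by norm_num)
      _ ≤ _ := le_mul_of_one_le_right' (ENNReal.one_le_rpow le_self_add (by norm_num))
  have hVU : ∀ z, harrisWeight D H η z ≤ ENNReal.ofReal ((1 + η * C) * (U z + 1)) := fun z =>
    calc harrisWeight D H η z ≤ 1 * (1 + ENNReal.ofReal η * H z) ^ (1 : ℝ) := by
          refine mul_le_mul' (ENNReal.rpow_le_one (hD1 z) (by norm_num)) ?_
          exact ENNReal.rpow_le_rpow_of_exponent_le le_self_add (by norm_num)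
      _ ≤ 1 + ENNReal.ofReal η * ENNReal.ofReal (C * (U z + 1)) := by
          rw [one_mul, ENNReal.rpow_one]; gcongr; exact hHU z
      _ = ENNReal.ofReal (1 + η * (C * (U z + 1))) := by
          have := hU0 z
          rw [ENNReal.ofReal_add zero_le_one (by positivity), ENNReal.ofReal_mul hη.le,
            ENNReal.ofReal_one]
      _ ≤ _ := ENNReal.ofReal_le_ofReal (by nlinarith [hU0 z])
  refine ⟨ρ, A * (1 + η * C), hρ, by positivity, fun x y n => ?_⟩
  have hrhs : 0 ≤ ρ ^ n * (A * (1 + η * C)) * (L x + L y + 1) := by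
    have := hρ.1
    have := hLnonneg x
    have := hLnonneg y
    positivity
  refine Real.sSup_le ?_ hrhs
  rintro _ ⟨f, hfc, hf1, hflip, rfl⟩
  have hfm := hfc.measurable
  rw [integral_iterate_bind _ hfm hf1, integral_iterate_bind _ hfm hf1,
    integral_dirac' _ _ (measurable_markovOp_iterate hfm n).stronglyMeasurable,
    integral_dirac' _ _ (measurable_markovOp_iterate hfm n).stronglyMeasurable,
    ← ENNReal.ofReal_le_ofReal_iff hrhs]
  have hfV : ∀ z : X × X,
      ENNReal.ofReal |f z.1 - f z.2| ≤ ENNReal.ofReal A * harrisWeight D H η z := fun z => by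
    have h2 : |f z.1 - f z.2| ≤ 2 := by
      linarith [abs_sub (f z.1) (f z.2), hf1 z.1, hf1 z.2]
    calc ENNReal.ofReal |f z.1 - f z.2| ≤ ENNReal.ofReal (min 2 (d z)) :=
          ENNReal.ofReal_le_ofReal (le_min h2 (hflip _ _))
      _ ≤ ENNReal.ofReal A * D z := hAD z
      _ ≤ _ := by gcongr; exact hDV z
  calc _ ≤ ENNReal.ofReal A * (ENNReal.ofReal ρ ^ n * harrisWeight D H η (x, y)) :=
        abs_markovOp_iterate_sub_le hfst hsnd hVm hV hfm hf1 hfV n (x, y)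
    _ ≤ ENNReal.ofReal A * (ENNReal.ofReal ρ ^ n *
          ENNReal.ofReal ((1 + η * C) * (U (x, y) + 1))) := by
        gcongr; exact hVU _
    _ = _ := by
        rw [← ENNReal.ofReal_pow hρ.1.le, ← ENNReal.ofReal_mul (pow_nonneg hρ.1.le n),
          ← ENNReal.ofReal_mul hA.le]
        congr 1; simp only [hU]; ring

end
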